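/- Let α ∈ (0,1], η, τ > 0, and let σ: [0,1] → ℝ be continuously differentiable. Define ε(t) = (1/η^α) ∫₀ᵗ (t−s)^{α−1} E_{α,α}(−((t−s)/τ)^α) σ(s) ds. Then for every t ∈ [0,1], ε(t) = (1/η^α) t^α E_{α,α+1}(−(t/τ)^α) σ(0) + (1/η^α) ∫₀ᵗ (t−s)^α E_{α,α+1}(−((t−s)/τ)^α) σ′(s) ds. -/

import Mathlib

/-- The generalized Mittag-Leffler function `E_{a,b}(t) = ∑_{n=0}^∞ tⁿ/Γ(a n + b)`. -/
noncomputable def mittagLeffler (a b t : ℝ) : ℝ := ∑' n : ℕ, t ^ n / Real.Gamma (a * n + b)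

open MeasureTheory Set Filter Topology

/-- Splitting Euler's integral at `M` bounds the Gamma function below by a geometric function. -/
theorem Real.exp_neg_mul_rpow_le_Gamma {M x : ℝ} (hM : 0 < M) (hx : 1 ≤ x) :
    Real.exp (-M) * M ^ (x - 1) ≤ Real.Gamma x := by
  have hconv := Real.GammaIntegral_convergent (show 0 < x by linarith)
  have hsub : Ioi M ⊆ Ioi (0 : ℝ) := Ioi_subset_Ioi hM.le
  rw [Real.Gamma_eq_integral (by linarith)]
  calc Real.exp (-M) * M ^ (x - 1) = ∫ y in Ioi M, Real.exp (-y) * M ^ (x - 1) := by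
        rw [integral_mul_const, integral_exp_neg_Ioi]
    _ ≤ ∫ y in Ioi M, Real.exp (-y) * y ^ (x - 1) := by
        refine setIntegral_mono_on ((integrableOn_exp_neg_Ioi M).mul_const _)
          (hconv.mono_set hsub) measurableSet_Ioi fun y hy => ?_
        gcongr
        exact le_of_lt hy
    _ ≤ ∫ y in Ioi 0, Real.exp (-y) * y ^ (x - 1) := by
        refine setIntegral_mono_set hconv ?_ hsub.eventuallyLE
        filter_upwards [ae_restrict_mem measurableSet_Ioi] with y hy
        have : (0 : ℝ) < y := hy
        simp only [Pi.zero_apply]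
        positivity

theorem summable_pow_div_Gamma {a : ℝ} (ha : 0 < a) (b R : ℝ) :
    Summable fun n : ℕ => R ^ n / Real.Gamma (a * n + b) := by
  set M : ℝ := (2 * (|R| + 1)) ^ a⁻¹
  have hM : 0 < M := by positivity
  have hMa : M ^ a = 2 * (|R| + 1) := Real.rpow_inv_rpow (by positivity) ha.ne'
  have hq : |R| / M ^ a < 1 := by
    rw [hMa, div_lt_one (by positivity)]
    linarith [abs_nonneg R]
  refine ((summable_geometric_of_lt_one (by positivity) hq).mul_left
    (Real.exp M * M ^ (1 - b))).of_norm_bounded_eventually_nat ?_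
  have hlarge : ∀ᶠ n : ℕ in atTop, 1 ≤ a * n + b :=
    (tendsto_atTop_add_const_right _ b
      (tendsto_natCast_atTop_atTop.const_mul_atTop ha)).eventually_ge_atTop 1
  filter_upwards [hlarge] with n hn
  have hG := Real.exp_neg_mul_rpow_le_Gamma hM hn
  have hG0 : 0 < Real.Gamma (a * n + b) := Real.Gamma_pos_of_pos (by linarith)
  rw [norm_div, norm_pow, Real.norm_eq_abs, Real.norm_of_nonneg hG0.le]
  calc |R| ^ n / Real.Gamma (a * n + b)
      ≤ |R| ^ n / (Real.exp (-M) * M ^ (a * n + b - 1)) := by gcongr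
    _ = Real.exp M * M ^ (1 - b) * (|R| / M ^ a) ^ n := by
        have h1 : M ^ (a * n + b - 1) = (M ^ a) ^ n / M ^ (1 - b) := by
          rw [← Real.rpow_mul_natCast hM.le, ← Real.rpow_sub hM]
          ring_nf
        rw [h1, Real.exp_neg, div_pow]
        field_simp

theorem continuous_mittagLeffler {a b : ℝ} (ha : 0 < a) (hb : 0 < b) :
    Continuous (mittagLeffler a b) := by
  rw [continuous_iff_continuousAt]
  intro x
  refine ContinuousOn.continuousAt (s := Icc (-(|x| + 1)) (|x| + 1)) ?_
    (Icc_mem_nhds (by linarith [neg_abs_le x]) (by linarith [le_abs_self x]))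
  refine continuousOn_tsum (fun n => by fun_prop) (summable_pow_div_Gamma ha b (|x| + 1)) ?_
  intro n y hy
  have hG0 : 0 < Real.Gamma (a * n + b) := Real.Gamma_pos_of_pos (by positivity)
  rw [norm_div, norm_pow, Real.norm_eq_abs, Real.norm_of_nonneg hG0.le]
  gcongr
  exact abs_le.2 hy

/-- The antiderivative formula for the relaxation kernel `x ^ (α - 1) E_{α,α}(-(x / τ) ^ α)`. -/
theorem hasDerivAt_rpow_mul_mittagLeffler {α τ x : ℝ} (hα : 0 < α) (hτ : 0 < τ) (hx : 0 < x) :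
    HasDerivAt (fun y => y ^ α * mittagLeffler α (α + 1) (-((y / τ) ^ α)))
      (x ^ (α - 1) * mittagLeffler α α (-((x / τ) ^ α))) x := by
  have hterm : ∀ (n : ℕ) (y : ℝ), y ∈ Ioo (x / 2) (2 * x) →
      HasDerivAt (fun y : ℝ => y ^ α * ((-((y / τ) ^ α)) ^ n / Real.Gamma (α * n + (α + 1))))
        (y ^ (α - 1) * ((-((y / τ) ^ α)) ^ n / Real.Gamma (α * n + α))) y := by
    intro n y hy
    have hy0 : 0 < y := by linarith [hy.1]
    have hp : 0 < α * n + α := by positivity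
    have hG0 : 0 < Real.Gamma (α * n + α) := Real.Gamma_pos_of_pos hp
    have hrw : ∀ z : ℝ, 0 < z → ∀ p : ℝ, z ^ p * (-((z / τ) ^ α)) ^ n =
        (-(τ ^ α)⁻¹) ^ n * z ^ (α * n + p) := by
      intro z hz p
      rw [Real.div_rpow hz.le hτ.le, Real.rpow_add hz, Real.rpow_mul_natCast hz.le,
        show -(z ^ α / τ ^ α) = -(τ ^ α)⁻¹ * z ^ α by ring, mul_pow]
      ring
    have hd := ((Real.hasDerivAt_rpow_const (x := y) (p := α * n + α) (Or.inl hy0.ne')).const_mul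
      ((-(τ ^ α)⁻¹) ^ n)).div_const (Real.Gamma (α * n + (α + 1)))
    refine (hd.congr_of_eventuallyEq ?_).congr_deriv ?_
    · filter_upwards [Ioi_mem_nhds hy0] with z hz
      rw [← mul_div_assoc, hrw z hz]
    · rw [← mul_div_assoc, hrw y hy0, ← add_assoc, Real.Gamma_add_one hp.ne', ← add_sub_assoc]
      field_simp
  have hsum : ∀ (b y : ℝ), Summable fun n : ℕ =>
      y ^ α * ((-((y / τ) ^ α)) ^ n / Real.Gamma (α * n + b)) :=
    fun b y => (summable_pow_div_Gamma hα b _).mul_left _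
  have hmem : x ∈ Ioo (x / 2) (2 * x) := ⟨by linarith, by linarith⟩
  have hbound : ∀ (n : ℕ) (y : ℝ), y ∈ Ioo (x / 2) (2 * x) →
      ‖y ^ (α - 1) * ((-((y / τ) ^ α)) ^ n / Real.Gamma (α * n + α))‖ ≤
        ((2 * x) ^ α / (x / 2)) * (((2 * x / τ) ^ α) ^ n / Real.Gamma (α * n + α)) := by
    intro n y hy
    have hy0 : 0 < y := by linarith [hy.1]
    have hG0 : 0 < Real.Gamma (α * n + α) := Real.Gamma_pos_of_pos (by positivity)
    rw [norm_mul, norm_div, norm_pow, norm_neg, Real.norm_of_nonneg hG0.le,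
      Real.norm_of_nonneg (by positivity), Real.norm_of_nonneg (by positivity),
      Real.rpow_sub_one hy0.ne']
    gcongr
    exacts [hy.2.le, hy.1.le, hy.2.le]
  have h := hasDerivAt_tsum_of_isPreconnected
    ((summable_pow_div_Gamma hα α ((2 * x / τ) ^ α)).mul_left ((2 * x) ^ α / (x / 2)))
    isOpen_Ioo isPreconnected_Ioo hterm hbound hmem (hsum (α + 1) x) hmem
  simpa only [tsum_mul_left, mittagLeffler] using h

/-- Integration by parts for the fractional strain: for continuously differentiable
stress `σ`, `ε(t) = (1/η^α) t^α E_{α,α+1}(−(t/τ)^α) σ(0)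
+ (1/η^α) ∫₀ᵗ (t−s)^α E_{α,α+1}(−((t−s)/τ)^α) σ′(s) ds`. -/
theorem fractional_strain_integration_by_parts
    (α η τ : ℝ) (hα : α ∈ Set.Ioc (0:ℝ) 1) (hη : 0 < η) (hτ : 0 < τ)
    (σ : ℝ → ℝ) (hσ : ContDiff ℝ 1 σ)
    (ε : ℝ → ℝ)
    (hε : ∀ t ∈ Set.Icc (0:ℝ) 1, ε t =
      (1 / η ^ α) * ∫ s in (0:ℝ)..t,
        (t - s) ^ (α - 1) * mittagLeffler α α (-(((t - s) / τ) ^ α)) * σ s) :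
    ∀ t ∈ Set.Icc (0:ℝ) 1, ε t =
      (1 / η ^ α) * t ^ α * mittagLeffler α (α + 1) (-((t / τ) ^ α)) * σ 0 +
      (1 / η ^ α) * ∫ s in (0:ℝ)..t,
        (t - s) ^ α * mittagLeffler α (α + 1) (-(((t - s) / τ) ^ α)) * deriv σ s := by
  obtain ⟨hα0, -⟩ := hα
  intro t ht
  have hle := ht.1
  have hE : ∀ b : ℝ, 0 < b → Continuous fun s : ℝ => mittagLeffler α b (-(((t - s) / τ) ^ α)) :=
    fun b hb => (continuous_mittagLeffler hα0 hb).comp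
      ((((continuous_const.sub continuous_id).div_const τ).rpow_const
        fun _ => Or.inr hα0.le).neg)
  have hu : Continuous fun s : ℝ =>
      -((t - s) ^ α * mittagLeffler α (α + 1) (-(((t - s) / τ) ^ α))) :=
    (((continuous_const.sub continuous_id).rpow_const fun _ => Or.inr hα0.le).mul
      (hE _ (by linarith))).neg
  have hderiv : ∀ s ∈ Ioo (min 0 t) (max 0 t), HasDerivAt (fun s : ℝ =>
      -((t - s) ^ α * mittagLeffler α (α + 1) (-(((t - s) / τ) ^ α))))
      ((t - s) ^ (α - 1) * mittagLeffler α α (-(((t - s) / τ) ^ α))) s := by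
    intro s hs
    rw [max_eq_right hle] at hs
    have h := ((hasDerivAt_rpow_mul_mittagLeffler hα0 hτ (sub_pos.2 hs.2)).comp s
      ((hasDerivAt_id s).const_sub t)).neg
    exact h.congr_deriv (by ring)
  have hint : IntervalIntegrable
      (fun s : ℝ => (t - s) ^ (α - 1) * mittagLeffler α α (-(((t - s) / τ) ^ α)))
      volume 0 t := by
    have h := (intervalIntegral.intervalIntegrable_rpow' (a := 0) (b := t)
      (show -1 < α - 1 by linarith)).comp_sub_left t
    simp only [sub_zero, sub_self] at h
    exact h.symm.mul_continuousOn (hE α hα0).continuousOn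
  have hparts := intervalIntegral.integral_mul_deriv_eq_deriv_mul_of_hasDerivAt
    (v := σ) (v' := deriv σ) hu.continuousOn hσ.continuous.continuousOn hderiv
    (fun s _ => (hσ.differentiable one_ne_zero s).hasDerivAt) hint
    ((hσ.continuous_deriv le_rfl).intervalIntegrable 0 t)
  simp only [neg_mul, intervalIntegral.integral_neg, sub_self, sub_zero,
    Real.zero_rpow hα0.ne', zero_mul, neg_zero] at hparts
  rw [hε t ht]
  linear_combination (1 / η ^ α) * hparts
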